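/- Relative twofold mixing fails to imply relative threefold mixing: there exists a measure-preserving system (X,𝓐,μ,T) with invariant sub-σ-algebra 𝓗 such that for all A,B ∈ 𝓐, μ(A∩T⁻ᵏB|𝓗) − μ(A|𝓗)μ(T⁻ᵏB|𝓗) → 0 in probability, but there exist A,B,C ∈ 𝓐 and sequences jₘ → ∞, kₘ − jₘ → ∞ with μ(A∩T⁻ʲᵐB∩T⁻ᵏᵐC|𝓗) − μ(A|𝓗)μ(T⁻ʲᵐB|𝓗)μ(T⁻ᵏᵐC|𝓗) not converging to 0 in probability. -/

import Mathlib

open MeasureTheory Filter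

namespace RelMix

/-- The `n`-th ternary digit of a 3-adic integer. -/
noncomputable def dig (n : ℕ) (x : ℤ_[3]) : ℤ :=
  ((PadicInt.toZModPow (n + 1) x).val : ℤ) / 3 ^ n

/-- The `n`-th ternary digit of an integer. -/
def dg (n : ℕ) (a : ℤ) : ℤ := a / 3 ^ n % 3

lemma dg_nonneg (n : ℕ) (a : ℤ) : 0 ≤ dg n a := Int.emod_nonneg _ (by norm_num)
lemma dg_lt (n : ℕ) (a : ℤ) : dg n a < 3 := Int.emod_lt_of_pos _ (by norm_num)

lemma emod_div_pow (n : ℕ) (a : ℤ) : a % 3 ^ (n + 1) / 3 ^ n = dg n a := by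
  have h3 : (0 : ℤ) < 3 ^ n := by positivity
  have h1 : a % 3 ^ (n + 1) = a - 3 ^ n * (3 * (a / 3 ^ n / 3)) := by
    rw [Int.emod_def, pow_succ, Int.ediv_ediv_of_nonneg h3.le]; ring
  rw [h1, dg, Int.sub_mul_ediv_left _ _ h3.ne', Int.emod_def]

lemma dig_eq {N : ℕ} {x : ℤ_[3]} {a : ℤ} (h : PadicInt.toZModPow N x = (a : ZMod (3 ^ N)))
    {n : ℕ} (hn : n < N) : dig n x = dg n a := by
  have h1 : PadicInt.toZModPow (n + 1) x = (a : ZMod (3 ^ (n + 1))) := by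
    rw [← PadicInt.cast_toZModPow (n + 1) N hn x, h]
    have : (3 ^ (n + 1)) ∣ 3 ^ N := pow_dvd_pow 3 hn
    exact ZMod.cast_intCast this a
  rw [dig, h1, ZMod.val_intCast]
  push_cast
  exact emod_div_pow n a

lemma exists_int (N : ℕ) (x : ℤ_[3]) : ∃ a : ℤ, PadicInt.toZModPow N x = (a : ZMod (3 ^ N)) :=
  ⟨((PadicInt.toZModPow N x).val : ℤ), by simp⟩

lemma toZ_add {N : ℕ} {x : ℤ_[3]} {a : ℤ} (h : PadicInt.toZModPow N x = (a : ZMod (3 ^ N)))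
    (k : ℤ) : PadicInt.toZModPow N (x + (k : ℤ_[3])) = ((a + k : ℤ) : ZMod (3 ^ N)) := by
  simp [h]

lemma dg_of_eq_div {n m : ℕ} (hm : m ≤ n) {a b : ℤ} (h : a / 3 ^ m = b / 3 ^ m) :
    dg n a = dg n b := by
  have h3 : (0 : ℤ) ≤ 3 ^ m := by positivity
  obtain ⟨t, rfl⟩ := Nat.exists_eq_add_of_le hm
  rw [dg, dg, pow_add, ← Int.ediv_ediv_of_nonneg h3, ← Int.ediv_ediv_of_nonneg h3, h]

lemma dg_set_same (d : ℕ) (a c : ℤ) (h0 : 0 ≤ c) (h3 : c < 3) :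
    dg d (a + (c - dg d a) * 3 ^ d) = c := by
  have hp : (3 : ℤ) ^ d ≠ 0 := by positivity
  rw [dg, Int.add_mul_ediv_right _ _ hp, dg]
  omega

lemma dg_set_ne {d n : ℕ} (hn : n ≠ d) (a c : ℤ) (h0 : 0 ≤ c) (h3 : c < 3) :
    dg n (a + (c - dg d a) * 3 ^ d) = dg n a := by
  have hp : (3 : ℤ) ^ d ≠ 0 := by positivity
  have hp' : (0 : ℤ) ≤ 3 ^ d := by positivity
  rcases lt_or_gt_of_ne hn with h | h
  · obtain ⟨t, rfl⟩ := Nat.exists_eq_add_of_lt h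
    have hq : (3 : ℤ) ^ n ≠ 0 := by positivity
    have : a + (c - dg (n + t + 1) a) * 3 ^ (n + t + 1)
        = a + (3 * ((c - dg (n + t + 1) a) * 3 ^ t)) * 3 ^ n := by ring
    rw [this]
    unfold dg
    rw [Int.add_mul_ediv_right _ _ hq, Int.add_mul_emod_self_left]
  · apply dg_of_eq_div (m := d + 1) h
    rw [pow_succ, ← Int.ediv_ediv_of_nonneg hp', ← Int.ediv_ediv_of_nonneg hp',
      Int.add_mul_ediv_right _ _ hp]
    unfold dg
    omega

lemma dig_set_same (d : ℕ) (x : ℤ_[3]) (j c : ℤ) (h0 : 0 ≤ c) (h3 : c < 3) :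
    dig d (x + ((j + (c - dig d (x + (j : ℤ_[3]))) * 3 ^ d : ℤ) : ℤ_[3])) = c := by
  obtain ⟨a, ha⟩ := exists_int (d + 1) x
  rw [dig_eq (toZ_add ha j) (Nat.lt_succ_self d), dig_eq (toZ_add ha _) (Nat.lt_succ_self d),
    ← add_assoc]
  exact dg_set_same d _ c h0 h3

lemma dig_set_ne {d n : ℕ} (hn : n ≠ d) (x : ℤ_[3]) (j c : ℤ) (h0 : 0 ≤ c) (h3 : c < 3) :
    dig n (x + ((j + (c - dig d (x + (j : ℤ_[3]))) * 3 ^ d : ℤ) : ℤ_[3]))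
      = dig n (x + (j : ℤ_[3])) := by
  obtain ⟨a, ha⟩ := exists_int (max d n + 1) x
  have h1 : d < max d n + 1 := by omega
  have h2 : n < max d n + 1 := by omega
  rw [dig_eq (toZ_add ha j) h1, dig_eq (toZ_add ha _) h2, dig_eq (toZ_add ha _) h2, ← add_assoc]
  exact dg_set_ne hn _ c h0 h3

lemma dig_range (n : ℕ) (x : ℤ_[3]) : dig n x = 0 ∨ dig n x = 1 ∨ dig n x = 2 := by
  obtain ⟨a, ha⟩ := exists_int (n + 1) x
  rw [dig_eq ha (Nat.lt_succ_self n)]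
  have := dg_nonneg n a
  have := dg_lt n a
  omega

/-- Digits along a line. -/
lemma dig_line_same {n : ℕ} {x : ℤ_[3]} {k : ℤ} (h : dig n (x + (k : ℤ_[3])) = 0) (c : ℤ)
    (h0 : 0 ≤ c) (h3 : c < 3) : dig n (x + ((k + c * 3 ^ n : ℤ) : ℤ_[3])) = c := by
  have := dig_set_same n x k c h0 h3
  rwa [h, sub_zero] at this

lemma dig_line_ne {n d : ℕ} (hd : d ≠ n) {x : ℤ_[3]} {k : ℤ} (h : dig n (x + (k : ℤ_[3])) = 0)
    (c : ℤ) (h0 : 0 ≤ c) (h3 : c < 3) :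
    dig d (x + ((k + c * 3 ^ n : ℤ) : ℤ_[3])) = dig d (x + (k : ℤ_[3])) := by
  have := dig_set_ne hd x k c h0 h3
  rwa [h, sub_zero] at this

/-! ### Relations -/

/-- The line through `k` in direction `n`. -/
noncomputable def line (p : ℤ × ℕ) : ℤ →₀ ZMod 2 :=
  Finsupp.single (p.1 + 0 * 3 ^ p.2) 1 + Finsupp.single (p.1 + 1 * 3 ^ p.2) 1
    + Finsupp.single (p.1 + 2 * 3 ^ p.2) 1

/-- The active lines over `x`. -/
def act (x : ℤ_[3]) : Set (ℤ × ℕ) := {p | dig p.2 (x + (p.1 : ℤ_[3])) = 0}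

/-- The space of relations over `x`. -/
noncomputable def Rel (x : ℤ_[3]) : Submodule (ZMod 2) (ℤ →₀ ZMod 2) :=
  Submodule.span (ZMod 2) (line '' act x)

/-- The pairing. -/
noncomputable def pr (u : ℤ → ZMod 2) : (ℤ →₀ ZMod 2) →ₗ[ZMod 2] ZMod 2 :=
  Finsupp.linearCombination (ZMod 2) u

/-- The annihilator of the relations. -/
def K (x : ℤ_[3]) : Set (ℤ → ZMod 2) := {u | ∀ p ∈ act x, pr u (line p) = 0}

lemma pr_single (u : ℤ → ZMod 2) (i : ℤ) : pr u (Finsupp.single i 1) = u i := by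
  simp [pr]

lemma pr_line (u : ℤ → ZMod 2) (p : ℤ × ℕ) : pr u (line p) =
    u (p.1 + 0 * 3 ^ p.2) + u (p.1 + 1 * 3 ^ p.2) + u (p.1 + 2 * 3 ^ p.2) := by
  simp only [line, map_add, pr_single]

lemma pr_add (u v : ℤ → ZMod 2) (s) : pr (u + v) s = pr u s + pr v s := by
  simp [pr, Finsupp.linearCombination_apply, Finsupp.sum, mul_add, Finset.sum_add_distrib]

lemma pr_eq_zero {x : ℤ_[3]} {s} (hs : s ∈ Rel x) {u} (hu : u ∈ K x) : pr u s = 0 := by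
  have : Rel x ≤ LinearMap.ker (pr u) := by
    rw [Rel, Submodule.span_le]
    rintro _ ⟨p, hp, rfl⟩
    exact hu p hp
  exact this hs

lemma exists_K {x : ℤ_[3]} {s} (hs : s ∉ Rel x) : ∃ u ∈ K x, pr u s = 1 := by
  obtain ⟨f, hf, hle⟩ := Submodule.exists_le_ker_of_notMem hs
  have hfu : pr (fun i => f (Finsupp.single i 1)) = f := by
    ext i; simp [pr]
  refine ⟨fun i => f (Finsupp.single i 1), ?_, ?_⟩
  · intro p hp
    rw [hfu]
    exact hle (Submodule.subset_span ⟨p, hp, rfl⟩)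
  · rw [hfu]
    generalize f s = t at hf
    revert t; decide

lemma K_shift {x : ℤ_[3]} {u} (hu : u ∈ K x) : (fun i => u (i + 1)) ∈ K (x + 1) := by
  intro p hp
  have : (p.1 + 1, p.2) ∈ act x := by
    simp only [act, Set.mem_ofPred_eq] at hp ⊢
    rw [← hp]; congr 1; push_cast; ring
  have := hu _ this
  rw [pr_line] at this ⊢
  rw [← this]
  simp only
  congr 1; congr 1
  all_goals congr 1; ring

/-- The digit projection: kills points whose `d`-th digit is `q`, and sets the `d`-th digit of
the others to `p`. -/
noncomputable def proj (x : ℤ_[3]) (d : ℕ) (p q : ℤ) :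
    (ℤ →₀ ZMod 2) →ₗ[ZMod 2] (ℤ →₀ ZMod 2) :=
  Finsupp.linearCombination (ZMod 2) (fun j : ℤ => if dig d (x + (j : ℤ_[3])) = q then 0 else
    Finsupp.single (j + (p - dig d (x + (j : ℤ_[3]))) * 3 ^ d) 1)

lemma proj_single (x : ℤ_[3]) (d : ℕ) (p q j : ℤ) : proj x d p q (Finsupp.single j 1) =
    if dig d (x + (j : ℤ_[3])) = q then 0 else
    Finsupp.single (j + (p - dig d (x + (j : ℤ_[3]))) * 3 ^ d) 1 := by
  simp [proj]

lemma two_zero (v : ℤ →₀ ZMod 2) : v + v = 0 := by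
  ext i
  simp only [Finsupp.add_apply, Finsupp.zero_apply]
  generalize v i = t
  revert t; decide

lemma proj_Rel (x : ℤ_[3]) (d : ℕ) (p q : ℤ) (hp : p = 0 ∨ p = 1 ∨ p = 2)
    (hq : q = 0 ∨ q = 1 ∨ q = 2) {s} (hs : s ∈ Rel x) :
    proj x d p q s ∈ Rel x := by
  have hp0 : 0 ≤ p := by omega
  have hp3 : p < 3 := by omega
  have : Rel x ≤ (Rel x).comap (proj x d p q) := by
    conv_lhs => rw [Rel]
    rw [Submodule.span_le]
    rintro _ ⟨⟨k, n⟩, hkn, rfl⟩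
    have hkn' : dig n (x + (k : ℤ_[3])) = 0 := hkn
    simp only [SetLike.mem_coe, Submodule.mem_comap, line, map_add, proj_single]
    by_cases hnd : n = d
    · subst hnd
      rw [dig_line_same hkn' 0 (by norm_num) (by norm_num),
        dig_line_same hkn' 1 (by norm_num) (by norm_num),
        dig_line_same hkn' 2 (by norm_num) (by norm_num)]
      have e : ∀ c : ℤ, k + c * 3 ^ n + (p - c) * 3 ^ n = k + p * 3 ^ n := by intro c; ring
      simp only [e]
      have := two_zero (Finsupp.single (k + p * 3 ^ n) 1)
      rcases hq with rfl | rfl | rfl <;> simp [this]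
    · have hdn : d ≠ n := Ne.symm hnd
      rw [dig_line_ne hdn hkn' 0 (by norm_num) (by norm_num),
        dig_line_ne hdn hkn' 1 (by norm_num) (by norm_num),
        dig_line_ne hdn hkn' 2 (by norm_num) (by norm_num)]
      by_cases hc : dig d (x + (k : ℤ_[3])) = q
      · simp [hc]
      · simp only [hc, if_false]
        have h1 : (k + (p - dig d (x + (k : ℤ_[3]))) * 3 ^ d, n) ∈ act x := by
          show dig n _ = 0
          rw [dig_set_ne hnd x k p hp0 hp3, hkn']
        have h2 := Submodule.subset_span (R := ZMod 2) (Set.mem_image_of_mem line h1)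
        rw [Rel]
        refine (congrArg (· ∈ Submodule.span (ZMod 2) (line '' act x)) ?_).mpr h2
        simp only [line]
        congr 1
        · congr 1
          · congr 1; ring
          · congr 1; ring
        · congr 1; ring
  exact this hs

lemma eq_sum (s : ℤ →₀ ZMod 2) : s = ∑ j ∈ s.support, Finsupp.single j 1 := by
  conv_lhs => rw [← Finsupp.sum_single s]
  apply Finset.sum_congr rfl
  intro j hj
  congr 1
  have := Finsupp.mem_support_iff.mp hj
  generalize s j = t at *
  revert t; decide

/-- Splitting: the key algebraic fact behind relative twofold mixing. -/
lemma split {x : ℤ_[3]} {d : ℕ} {p q : ℤ} (hpq : p ≠ q) (hp : p = 0 ∨ p = 1 ∨ p = 2)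
    (hq : q = 0 ∨ q = 1 ∨ q = 2) {s s' : ℤ →₀ ZMod 2}
    (hs : ∀ j ∈ s.support, dig d (x + (j : ℤ_[3])) = p)
    (hs' : ∀ j ∈ s'.support, dig d (x + (j : ℤ_[3])) = q) (h : s + s' ∈ Rel x) :
    s ∈ Rel x := by
  have h1 := proj_Rel x d p q hp hq h
  have e1 : proj x d p q s = s := by
    conv_rhs => rw [eq_sum s]
    conv_lhs => rw [eq_sum s]
    rw [map_sum]
    apply Finset.sum_congr rfl
    intro j hj
    rw [proj_single, hs j hj]
    simp [hpq]
  have e2 : proj x d p q s' = 0 := by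
    conv_lhs => rw [eq_sum s']
    rw [map_sum]
    apply Finset.sum_eq_zero
    intro j hj
    rw [proj_single, hs' j hj]
    simp
  rwa [map_add, e1, e2, add_zero] at h1

/-- No single point is a relation. -/
lemma single_notMem (x : ℤ_[3]) (i : ℤ) : Finsupp.single i 1 ∉ Rel x := by
  classical
  intro h
  let c : ℕ → ℤ := fun n => if dig n (x + (i : ℤ_[3])) = 0 then 1 else 0
  let u : ℤ → ZMod 2 := fun j => if ∀ n, dig n (x + (j : ℤ_[3])) ≠ c n then 1 else 0
  have hu : u ∈ K x := by
    rintro ⟨k, n⟩ hkn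
    have hkn' : dig n (x + (k : ℤ_[3])) = 0 := hkn
    have key : ∀ e : ℤ, 0 ≤ e → e < 3 → u (k + e * 3 ^ n) =
        if (∀ m, m ≠ n → dig m (x + (k : ℤ_[3])) ≠ c m) ∧ e ≠ c n then 1 else 0 := by
      intro e h0 h3
      have : (∀ m, dig m (x + ((k + e * 3 ^ n : ℤ) : ℤ_[3])) ≠ c m) ↔
          ((∀ m, m ≠ n → dig m (x + (k : ℤ_[3])) ≠ c m) ∧ e ≠ c n) := by
        constructor
        · intro H
          refine ⟨fun m hm => ?_, ?_⟩
          · rw [← dig_line_ne hm hkn' e h0 h3]; exact H m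
          · have := H n; rwa [dig_line_same hkn' e h0 h3] at this
        · rintro ⟨H1, H2⟩ m
          by_cases hm : m = n
          · subst hm; rwa [dig_line_same hkn' e h0 h3]
          · rw [dig_line_ne hm hkn' e h0 h3]; exact H1 m hm
      simp only [u, this]
    rw [pr_line, key 0 (by norm_num) (by norm_num), key 1 (by norm_num) (by norm_num),
      key 2 (by norm_num) (by norm_num)]
    by_cases H : ∀ m, m ≠ n → dig m (x + (k : ℤ_[3])) ≠ c m
    · simp only [eq_true H, true_and]
      have : c n = 1 ∨ c n = 0 := by simp only [c]; split_ifs <;> simp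
      rcases this with h | h <;> rw [h] <;> decide
    · simp [H]
  have h1 := pr_eq_zero h hu
  rw [pr_single] at h1
  have : u i = 1 := by
    simp only [u, c]
    rw [if_pos]
    intro n
    split_ifs with h0
    · rw [h0]; norm_num
    · exact h0
  rw [this] at h1
  exact absurd h1 (by decide)

lemma dg_shift (m i : ℕ) (a : ℤ) : dg (m + i) a = dg i (a / 3 ^ m) := by
  rw [dg, dg, pow_add, ← Int.ediv_ediv_of_nonneg (by positivity)]

lemma emod_eq_of_dg (t : ℕ) (A B : ℤ) (h : ∀ d < t, dg d A = dg d B) :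
    A % 3 ^ t = B % 3 ^ t := by
  induction t with
  | zero => simp
  | succ t ih =>
    have h1 := ih fun d hd => h d (by omega)
    have h2 := h t (by omega)
    have key : ∀ C : ℤ, C % 3 ^ (t + 1) = C % 3 ^ t + dg t C * 3 ^ t := by
      intro C
      have e1 := Int.emod_def C (3 ^ (t + 1))
      have e2 := Int.emod_def C (3 ^ t)
      have e3 : dg t C = C / 3 ^ t - 3 * (C / 3 ^ t / 3) := by rw [dg, Int.emod_def]
      rw [e1, e2, e3, pow_succ, ← Int.ediv_ediv_of_nonneg (by positivity)]
      ring
    rw [key, key, h1, h2]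

lemma exists_dg {m N : ℕ} {a k : ℤ} (hmN : m ≤ N) (hk : 3 ^ m ≤ k) (hN : k + 3 ^ m < 3 ^ N) :
    ∃ d, m ≤ d ∧ d < N ∧ dg d a ≠ dg d (a + k) := by
  by_contra! H
  obtain ⟨t, rfl⟩ := Nat.exists_eq_add_of_le hmN
  have h1 : a / 3 ^ m % 3 ^ t = (a + k) / 3 ^ m % 3 ^ t := by
    apply emod_eq_of_dg
    intro d hd
    rw [← dg_shift, ← dg_shift]
    exact H _ (by omega) (by omega)
  have hm : (0 : ℤ) < 3 ^ m := by positivity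
  have ht : (0 : ℤ) < 3 ^ t := by positivity
  have e1 := Int.emod_add_mul_ediv a (3 ^ m)
  have e2 := Int.emod_add_mul_ediv (a + k) (3 ^ m)
  have l1 := Int.emod_nonneg a hm.ne'
  have l2 := Int.emod_lt_of_pos a hm
  have l3 := Int.emod_nonneg (a + k) hm.ne'
  have l4 := Int.emod_lt_of_pos (a + k) hm
  obtain ⟨c, hc⟩ := Int.ModEq.dvd h1
  rw [pow_add] at hN
  generalize (3 : ℤ) ^ m = P at *
  generalize (3 : ℤ) ^ t = Q at *
  have hBA : (a + k) / P = a / P + Q * c := by linarith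
  rw [hBA] at e2
  have hkk : k = P * (Q * c) + (a + k) % P - a % P := by linarith
  have hpos : 0 < P * (Q * c) := by linarith
  have hQc : 0 < Q * c := by
    by_contra hneg
    push Not at hneg
    nlinarith
  have hc1 : 1 ≤ c := by
    by_contra hneg
    push Not at hneg
    have : c ≤ 0 := by omega
    nlinarith
  have : P * Q ≤ P * (Q * c) := by
    apply mul_le_mul_of_nonneg_left _ hm.le
    nlinarith
  linarith

/-- Good windows. -/
lemma exists_digit {x : ℤ_[3]} {m M : ℕ} {k : ℕ} (hk : 3 ^ m ≤ k)
    (h1 : (PadicInt.toZModPow m (x - (M : ℤ_[3]))).val + 2 * M < 3 ^ m)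
    (h2 : (PadicInt.toZModPow m (x + (k : ℤ_[3]) - (M : ℤ_[3]))).val + 2 * M < 3 ^ m) :
    ∃ d, ∃ p q : ℤ, p ≠ q ∧
      (∀ j : ℤ, |j| ≤ M → dig d (x + (j : ℤ_[3])) = p) ∧
      (∀ j : ℤ, |j| ≤ M → dig d (x + ((j + k : ℤ) : ℤ_[3])) = q) := by
  have hN : (k : ℤ) + 3 ^ m < 3 ^ (m + k + 1) := by
    have a1 : k < 3 ^ k := Nat.lt_pow_self (by norm_num)
    have a2 : k + 3 ^ m < 3 ^ (m + k + 1) := by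
      have b1 : 1 ≤ 3 ^ m := Nat.one_le_pow _ _ (by norm_num)
      have b2 : 1 ≤ 3 ^ k := Nat.one_le_pow _ _ (by norm_num)
      have : 3 ^ (m + k + 1) = 3 ^ m * 3 ^ k * 3 := by ring
      rw [this]
      nlinarith [Nat.mul_le_mul b1 b2, Nat.mul_le_mul_left (3 ^ m) b2,
        Nat.mul_le_mul_right (3 ^ k) b1]
    exact_mod_cast a2
  obtain ⟨a, ha⟩ := exists_int (m + k + 1) (x - (M : ℤ_[3]))
  have hak := toZ_add ha k
  have hval : ∀ (y : ℤ_[3]) (b : ℤ), PadicInt.toZModPow (m + k + 1) y = (b : ZMod _) →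
      ((PadicInt.toZModPow m y).val : ℤ) = b % 3 ^ m := by
    intro y b hb
    have hmN : m ≤ m + k + 1 := by omega
    rw [← PadicInt.cast_toZModPow m (m + k + 1) hmN y, hb,
      ZMod.cast_intCast (pow_dvd_pow 3 hmN) b, ZMod.val_intCast]
    push_cast; rfl
  have g1 : a % 3 ^ m + 2 * M < 3 ^ m := by
    rw [← hval _ _ ha]; exact_mod_cast h1
  have g2 : (a + k) % 3 ^ m + 2 * M < 3 ^ m := by
    rw [← hval _ _ hak]
    have : x - (M : ℤ_[3]) + ((k : ℤ) : ℤ_[3]) = x + (k : ℤ_[3]) - (M : ℤ_[3]) := by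
      push_cast; ring
    rw [this]; exact_mod_cast h2
  obtain ⟨d, hmd, hdN, hne⟩ := exists_dg (a := a) (m := m) (N := m + k + 1) (k := k) (by omega)
    (by exact_mod_cast hk) hN
  have hm : (0 : ℤ) < 3 ^ m := by positivity
  have win : ∀ b : ℤ, b % 3 ^ m + 2 * M < 3 ^ m → ∀ t : ℤ, 0 ≤ t → t ≤ 2 * M →
      dg d (b + t) = dg d b := by
    intro b hb t h0 h2
    apply dg_of_eq_div hmd
    have e1 := Int.emod_add_mul_ediv b (3 ^ m)
    have l1 := Int.emod_nonneg b hm.ne'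
    have : b + t = (b % 3 ^ m + t) + 3 ^ m * (b / 3 ^ m) := by linarith
    rw [this, Int.add_mul_ediv_left _ _ hm.ne', Int.ediv_eq_zero_of_lt (by linarith) (by linarith),
      zero_add]
  refine ⟨d, dg d a, dg d (a + k), hne, ?_, ?_⟩
  · intro j hj
    rw [abs_le] at hj
    have e : x + (j : ℤ_[3]) = (x - (M : ℤ_[3])) + ((M + j : ℤ) : ℤ_[3]) := by push_cast; ring
    rw [e, dig_eq (toZ_add ha _) hdN]
    exact win a g1 _ (by linarith) (by linarith)
  · intro j hj
    rw [abs_le] at hj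
    have e : x + ((j + k : ℤ) : ℤ_[3]) = (x - (M : ℤ_[3])) + ((k + (M + j) : ℤ) : ℤ_[3]) := by
      push_cast; ring
    rw [e, dig_eq (toZ_add ha _) hdN, ← add_assoc]
    exact win (a + k) g2 _ (by linarith) (by linarith)

end RelMix

namespace RelMix
/-! ### The system -/

noncomputable instance instMS3 : MeasurableSpace ℤ_[3] := borel _
instance instBS3 : BorelSpace ℤ_[3] := ⟨rfl⟩

/-- Haar probability on the 3-adic integers. -/
noncomputable def nu : Measure ℤ_[3] := Measure.addHaarMeasure ⊤
/-- Haar probability on the fibre. -/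
noncomputable def lam : Measure (ℤ → ZMod 2) := Measure.addHaarMeasure ⊤

instance instNuHaar : nu.IsAddHaarMeasure := by unfold nu; infer_instance
instance instLamHaar : lam.IsAddHaarMeasure := by unfold lam; infer_instance
instance instNuProb : IsProbabilityMeasure nu := ⟨by
  have := Measure.addHaarMeasure_self (G := ℤ_[3]) (K₀ := ⊤)
  simpa [nu] using this⟩
instance instLamProb : IsProbabilityMeasure lam := ⟨by
  have := Measure.addHaarMeasure_self (G := ℤ → ZMod 2) (K₀ := ⊤)
  simpa [lam] using this⟩

/-- The phase space. -/
abbrev X : Type := ℤ_[3] × (ℤ → ZMod 2)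
/-- The invariant measure. -/
noncomputable def mu : Measure X := nu.prod lam
instance instMuProb : IsProbabilityMeasure mu := by unfold mu; infer_instance

/-- The transformation: odometer times shift. -/
noncomputable def T (w : X) : X := (w.1 + 1, fun i => w.2 (i + 1))

lemma T_iter (k : ℕ) (w : X) : T^[k] w = (w.1 + (k : ℤ_[3]), fun i => w.2 (i + k)) := by
  induction k with
  | zero => simp
  | succ k ih =>
    rw [Function.iterate_succ_apply', ih, T]
    simp only [Nat.cast_succ, Prod.mk.injEq]
    refine ⟨by ring, ?_⟩
    funext i
    ring_nf

lemma T_mp : MeasurePreserving T mu mu := by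
  have h1 : MeasurePreserving (fun x : ℤ_[3] => x + 1) nu nu := measurePreserving_add_right nu 1
  let f : (ℤ → ZMod 2) →+ (ℤ → ZMod 2) :=
    { toFun := fun z i => z (i + 1), map_zero' := rfl, map_add' := fun _ _ => rfl }
  have h2 : MeasurePreserving f lam lam := by
    apply AddMonoidHom.measurePreserving (μ := lam) (ν := lam)
    · show Continuous (fun (z : ℤ → ZMod 2) i => z (i + 1))
      fun_prop
    · intro z
      refine ⟨fun i => z (i - 1), ?_⟩
      funext i
      show z (i + 1 - 1) = z i
      simp
    · rfl
  exact h1.prod h2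

/-- The factor: sets invariant under fibre translations by the annihilator of the relations. -/
@[reducible]
def HH : MeasurableSpace X where
  MeasurableSet' A := MeasurableSet A ∧ ∀ x z, ∀ u ∈ K x, ((x, z + u) ∈ A ↔ (x, z) ∈ A)
  measurableSet_empty := ⟨MeasurableSet.empty, by simp⟩
  measurableSet_compl A hA := ⟨hA.1.compl, fun x z u hu => not_congr (hA.2 x z u hu)⟩
  measurableSet_iUnion f hf := ⟨MeasurableSet.iUnion fun i => (hf i).1, fun x z u hu => by
    simp only [Set.mem_iUnion]
    exact exists_congr fun i => (hf i).2 x z u hu⟩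

lemma HH_le : HH ≤ (inferInstance : MeasurableSpace X) := fun _ h => h.1

lemma HH_inv (s : Set X) (hs : MeasurableSet[HH] s) : MeasurableSet[HH] (T ⁻¹' s) := by
  refine ⟨T_mp.measurable hs.1, fun x z u hu => ?_⟩
  exact hs.2 (x + 1) (fun i => z (i + 1)) _ (K_shift hu)

lemma HH_measurable {f : X → ℝ} (hf : Measurable f)
    (h : ∀ x z, ∀ u ∈ K x, f (x, z + u) = f (x, z)) : Measurable[HH] f := by
  intro s hs
  refine ⟨hf hs, fun x z u hu => ?_⟩
  simp only [Set.mem_preimage, h x z u hu]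

/-! ### Characters -/

/-- The sign character. -/
def sg (t : ZMod 2) : ℝ := if t = 0 then 1 else -1

lemma sg_add (a b : ZMod 2) : sg (a + b) = sg a * sg b := by
  have h01 : ∀ t : ZMod 2, t = 0 ∨ t = 1 := by decide
  rcases h01 a with rfl | rfl <;> rcases h01 b with rfl | rfl <;> simp [sg]
  decide

lemma abs_sg (a : ZMod 2) : |sg a| = 1 := by
  unfold sg; split_ifs <;> simp

/-- Characters with coefficients depending on the base. -/
noncomputable def ch (U : Set ℤ_[3]) (s : ℤ →₀ ZMod 2) (w : X) : ℝ :=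
  U.indicator (fun _ => 1) w.1 * sg (pr w.2 s)

lemma measurable_pr (s : ℤ →₀ ZMod 2) : Measurable fun z : ℤ → ZMod 2 => pr z s := by
  simp only [pr, Finsupp.linearCombination_apply, Finsupp.sum]
  refine Finset.measurable_sum _ fun i _ => ?_
  exact (measurable_of_countable (fun t : ZMod 2 => s i • t)).comp (measurable_pi_apply i)

lemma measurable_ch {U : Set ℤ_[3]} (hU : MeasurableSet U) (s) : Measurable (ch U s) := by
  unfold ch
  apply Measurable.mul
  · exact (measurable_const.indicator hU).comp measurable_fst
  · exact (measurable_of_countable sg).comp ((measurable_pr s).comp measurable_snd)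

lemma abs_ch_le (U s w) : |ch U s w| ≤ 1 := by
  classical
  rw [ch, abs_mul, abs_sg, mul_one, Set.indicator_apply]
  split_ifs <;> simp

lemma integrable_of_bdd {f : X → ℝ} (hf : Measurable f) {C : ℝ} (h : ∀ w, |f w| ≤ C) :
    Integrable f mu :=
  Integrable.of_bound hf.aestronglyMeasurable C (Eventually.of_forall h)

lemma integrable_ch {U : Set ℤ_[3]} (hU : MeasurableSet U) (s) : Integrable (ch U s) mu :=
  integrable_of_bdd (measurable_ch hU s) (abs_ch_le U s)

/-- Base points where `s` is a relation. -/
def RS (s : ℤ →₀ ZMod 2) : Set ℤ_[3] := {x | s ∈ Rel x}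

lemma measurable_toZ (n : ℕ) : Measurable (PadicInt.toZModPow (p := 3) n) := by
  apply measurable_to_countable'
  intro r
  apply IsOpen.measurableSet
  rw [Metric.isOpen_iff]
  intro x hx
  refine ⟨(3 : ℝ) ^ (-n : ℤ), by positivity, fun y hy => ?_⟩
  rw [Metric.mem_ball, dist_eq_norm] at hy
  have h1 := (PadicInt.norm_le_pow_iff_mem_span_pow (p := 3) (y - x) n).mp
    (by exact_mod_cast hy.le)
  rw [← PadicInt.ker_toZModPow, RingHom.mem_ker, map_sub, sub_eq_zero] at h1
  simp only [Set.mem_preimage, Set.mem_singleton_iff] at hx ⊢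
  rw [h1, hx]

lemma measurable_add_const3 (k : ℤ_[3]) : Measurable fun x : ℤ_[3] => x + k :=
  measurable_add_const k

lemma measurable_dig (n : ℕ) : Measurable (dig n) := by
  unfold dig
  exact (measurable_of_countable
    (fun t : ZMod (3 ^ (n + 1)) => (t.val : ℤ) / 3 ^ n)).comp (measurable_toZ (n + 1))

lemma measurableSet_act (p : ℤ × ℕ) : MeasurableSet {x | p ∈ act x} := by
  have : {x | p ∈ act x} = (fun x : ℤ_[3] => dig p.2 (x + (p.1 : ℤ_[3]))) ⁻¹' {0} := by
    ext x; rfl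
  rw [this]
  exact ((measurable_dig p.2).comp (measurable_add_const3 _)) (measurableSet_singleton 0)

lemma measurableSet_RS (s) : MeasurableSet (RS s) := by
  have : RS s = ⋃ l : (ℤ × ℕ) →₀ ZMod 2, ⋃ _ : Finsupp.linearCombination (ZMod 2) line l = s,
      ⋂ p ∈ l.support, {x | p ∈ act x} := by
    ext x
    simp only [RS, Rel, Set.mem_ofPred_eq, Finsupp.mem_span_image_iff_linearCombination,
      Set.mem_iUnion, Set.mem_iInter]
    constructor
    · rintro ⟨l, hl, h⟩
      exact ⟨l, h, fun p hp => hl hp⟩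
    · rintro ⟨l, h, hl⟩
      exact ⟨l, fun p hp => hl p hp, h⟩
  rw [this]
  refine MeasurableSet.iUnion fun l => MeasurableSet.iUnion fun _ => ?_
  exact Finset.measurableSet_biInter _ fun p _ => measurableSet_act p

lemma condExp_ch {U : Set ℤ_[3]} (hU : MeasurableSet U) (s) :
    mu[ch U s | HH] =ᵐ[mu] ch (U ∩ RS s) s := by
  classical
  have hUR := hU.inter (measurableSet_RS s)
  symm
  apply ae_eq_condExp_of_forall_setIntegral_eq HH_le (integrable_ch hU s)
  · intro _ _ _; exact (integrable_ch hUR s).integrableOn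
  · intro H hH _
    rw [← sub_eq_zero, ← integral_sub (integrable_ch hUR s).integrableOn
      (integrable_ch hU s).integrableOn, ← integral_indicator hH.1, mu, integral_prod]
    · apply integral_eq_zero_of_ae
      refine Eventually.of_forall fun x => ?_
      simp only [Pi.zero_apply]
      by_cases hx : x ∈ RS s
      · apply integral_eq_zero_of_ae
        refine Eventually.of_forall fun z => ?_
        have : ch (U ∩ RS s) s (x, z) = ch U s (x, z) := by
          simp only [ch, Set.indicator_apply, Set.mem_inter_iff, hx, and_true]
        simp [Set.indicator_apply, this]
      · obtain ⟨u, hu, hus⟩ := exists_K hx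
        have e := integral_add_right_eq_self (μ := lam)
          (fun z => H.indicator (fun w => ch (U ∩ RS s) s w - ch U s w) (x, z)) u
        have e2 : ∀ z, H.indicator (fun w => ch (U ∩ RS s) s w - ch U s w) (x, z + u)
            = - H.indicator (fun w => ch (U ∩ RS s) s w - ch U s w) (x, z) := by
          intro z
          have : sg (pr (z + u) s) = - sg (pr z s) := by
            rw [pr_add, sg_add, hus]; simp [sg]
          simp only [Set.indicator_apply, hH.2 x z u hu, ch, this]
          split_ifs <;> ring
        simp only [e2, integral_neg] at e
        linarith
    · exact ((integrable_ch hUR s).sub (integrable_ch hU s)).indicator hH.1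
  · apply StronglyMeasurable.aestronglyMeasurable
    apply Measurable.stronglyMeasurable
    apply HH_measurable (measurable_ch hUR s)
    intro x z u hu
    by_cases hx : x ∈ RS s
    · simp only [ch, pr_add, pr_eq_zero hx hu, add_zero]
    · simp [ch, hx]

end RelMix

namespace RelMix
/-! ### Small base sets -/

lemma nu_fibre (m : ℕ) (r : ZMod (3 ^ m)) :
    nu (PadicInt.toZModPow (p := 3) m ⁻¹' {r}) = nu (PadicInt.toZModPow (p := 3) m ⁻¹' {0}) := by
  have : PadicInt.toZModPow (p := 3) m ⁻¹' {r} = (fun x => x + (-(r.val : ℤ_[3]))) ⁻¹'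
      (PadicInt.toZModPow (p := 3) m ⁻¹' {0}) := by
    ext x
    have hr : PadicInt.toZModPow (p := 3) m (r.val : ℤ_[3]) = r := by
      rw [map_natCast, ZMod.natCast_zmod_val]
    simp only [Set.mem_preimage, Set.mem_singleton_iff, map_add, map_neg, hr]
    rw [add_neg_eq_zero]
  rw [this, measure_preimage_add_right]

lemma nu_finset (m : ℕ) (s : Finset (ZMod (3 ^ m))) :
    nu (PadicInt.toZModPow (p := 3) m ⁻¹' s) = s.card * (3⁻¹ : ENNReal) ^ m := by
  have key : ∀ s : Finset (ZMod (3 ^ m)), nu (PadicInt.toZModPow (p := 3) m ⁻¹' s)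
      = s.card * nu (PadicInt.toZModPow (p := 3) m ⁻¹' {0}) := by
    intro s
    rw [← sum_measure_preimage_singleton s fun y _ => measurable_toZ m (measurableSet_singleton y)]
    simp [nu_fibre]
  have h1 := key Finset.univ
  simp only [Finset.coe_univ, Set.preimage_univ, measure_univ, Finset.card_univ, ZMod.card] at h1
  rw [key s]
  congr 1
  rw [← ENNReal.inv_pow]
  refine ENNReal.eq_inv_of_mul_eq_one_left ?_
  rw [mul_comm, h1]
  push_cast; rfl

lemma nu_bad (m M : ℕ) : nu {x | 3 ^ m ≤ (PadicInt.toZModPow (p := 3) m x).val + 2 * M}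
    ≤ (2 * M : ℕ) * (3⁻¹ : ENNReal) ^ m := by
  classical
  have : {x | 3 ^ m ≤ (PadicInt.toZModPow (p := 3) m x).val + 2 * M} =
      PadicInt.toZModPow (p := 3) m ⁻¹'
        ((Finset.univ.filter fun r : ZMod (3 ^ m) => 3 ^ m ≤ r.val + 2 * M : Finset _) : Set _) := by
    ext x; simp
  rw [this, nu_finset]
  gcongr
  have h1 := Finset.card_le_card_of_injOn (s := Finset.univ.filter
    fun r : ZMod (3 ^ m) => 3 ^ m ≤ r.val + 2 * M) (t := Finset.Ico (3 ^ m - 2 * M) (3 ^ m))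
    ZMod.val (by
      intro r hr
      have := ZMod.val_lt r
      simp at hr ⊢
      omega) ((ZMod.val_injective _).injOn)
  rw [Nat.card_Ico] at h1
  omega

/-- The exceptional set of base points. -/
def Bad (m M k : ℕ) : Set ℤ_[3] :=
  {x | 3 ^ m ≤ (PadicInt.toZModPow (p := 3) m (x - (M : ℤ_[3]))).val + 2 * M} ∪
  {x | 3 ^ m ≤ (PadicInt.toZModPow (p := 3) m (x + (k : ℤ_[3]) - (M : ℤ_[3]))).val + 2 * M}

lemma nu_Bad_le (m M k : ℕ) : nu (Bad m M k) ≤ (4 * M : ℕ) * (3⁻¹ : ENNReal) ^ m := by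
  have h := nu_bad m M
  have tr : ∀ c : ℤ_[3], nu {x | 3 ^ m ≤ (PadicInt.toZModPow (p := 3) m (x + c)).val + 2 * M}
      ≤ (2 * M : ℕ) * (3⁻¹ : ENNReal) ^ m := by
    intro c
    have : {x | 3 ^ m ≤ (PadicInt.toZModPow (p := 3) m (x + c)).val + 2 * M} = (fun x => x + c) ⁻¹'
      {x | 3 ^ m ≤ (PadicInt.toZModPow (p := 3) m x).val + 2 * M} := rfl
    rw [this, measure_preimage_add_right]
    exact h
  refine (measure_union_le _ _).trans ?_
  have h1 := tr (-(M : ℤ_[3]))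
  have h2 := tr ((k : ℤ_[3]) - (M : ℤ_[3]))
  simp only [← sub_eq_add_neg] at h1
  simp only [← add_sub_assoc] at h2
  refine (add_le_add h1 h2).trans (le_of_eq ?_)
  rw [← add_mul]
  congr 1
  push_cast
  ring

/-! ### Conditional covariance -/

/-- Bounded measurable functions. -/
def Bd (f : X → ℝ) : Prop := Measurable f ∧ ∃ C : NNReal, ∀ w, |f w| ≤ C

lemma Bd.integrable {f} (h : Bd f) : Integrable f mu := by
  obtain ⟨C, hC⟩ := h.2
  exact integrable_of_bdd h.1 hC

lemma Bd.mul {f g} (hf : Bd f) (hg : Bd g) : Bd (f * g) := by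
  obtain ⟨C, hC⟩ := hf.2
  obtain ⟨C', hC'⟩ := hg.2
  refine ⟨hf.1.mul hg.1, C * C', fun w => ?_⟩
  rw [Pi.mul_apply, abs_mul]
  push_cast
  exact mul_le_mul (hC w) (hC' w) (abs_nonneg _) (C.2)

lemma Bd.add {f g} (hf : Bd f) (hg : Bd g) : Bd (f + g) := by
  obtain ⟨C, hC⟩ := hf.2
  obtain ⟨C', hC'⟩ := hg.2
  refine ⟨hf.1.add hg.1, C + C', fun w => ?_⟩
  rw [Pi.add_apply]
  push_cast
  exact (abs_add_le _ _).trans (add_le_add (hC w) (hC' w))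

lemma Bd.smul {f} (c : ℝ) (hf : Bd f) : Bd (c • f) := by
  obtain ⟨C, hC⟩ := hf.2
  refine ⟨hf.1.const_smul c, ‖c‖₊ * C, fun w => ?_⟩
  rw [Pi.smul_apply, smul_eq_mul, abs_mul]
  push_cast
  exact mul_le_mul_of_nonneg_left (hC w) (abs_nonneg _)

lemma Bd.comp {f} (hf : Bd f) (k : ℕ) : Bd (f ∘ T^[k]) :=
  ⟨hf.1.comp (T_mp.iterate k).measurable, hf.2.imp fun _ h w => h _⟩

lemma Bd_ch {U : Set ℤ_[3]} (hU : MeasurableSet U) (s) : Bd (ch U s) :=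
  ⟨measurable_ch hU s, 1, abs_ch_le U s⟩

lemma Bd_ind {A : Set X} (hA : MeasurableSet A) : Bd (A.indicator fun _ => (1 : ℝ)) :=
  ⟨measurable_const.indicator hA, 1, fun w => by
    classical
    rw [Set.indicator_apply]; split_ifs <;> simp⟩

/-- Conditional covariance given the factor. -/
noncomputable def cv (f g : X → ℝ) : X → ℝ := mu[f * g | HH] - mu[f | HH] * mu[g | HH]

lemma cv_comm (f g : X → ℝ) : cv f g = cv g f := by
  rw [cv, cv, mul_comm f g, mul_comm (mu[f | HH])]

lemma cv_aesm (f g : X → ℝ) : AEStronglyMeasurable (cv f g) mu := by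
  have h : ∀ f : X → ℝ, AEStronglyMeasurable (mu[f | HH]) mu := fun f =>
    integrable_condExp.aestronglyMeasurable
  exact (h _).sub ((h f).mul (h g))

lemma cv_add {f f' g : X → ℝ} (hf : Bd f) (hf' : Bd f') (hg : Bd g) :
    cv (f + f') g =ᵐ[mu] cv f g + cv f' g := by
  have e1 := condExp_add (m := HH) (hf.mul hg).integrable (hf'.mul hg).integrable
  have e2 := condExp_add (m := HH) hf.integrable hf'.integrable
  rw [← add_mul] at e1
  filter_upwards [e1, e2] with w h1 h2
  simp only [cv, Pi.sub_apply, Pi.mul_apply, Pi.add_apply] at *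
  rw [h1, h2]; ring

lemma cv_smul {f g : X → ℝ} (c : ℝ) : cv (c • f) g =ᵐ[mu] c • cv f g := by
  have e1 := condExp_smul (μ := mu) c (f * g) HH
  have e2 := condExp_smul (μ := mu) c f HH
  rw [← smul_mul_assoc] at e1
  filter_upwards [e1, e2] with w h1 h2
  simp only [cv, Pi.sub_apply, Pi.mul_apply, Pi.smul_apply, smul_eq_mul] at *
  rw [h1, h2]; ring

lemma cv_le {f g : X → ℝ} (hg : ∀ w, |g w| ≤ 1) :
    eLpNorm (cv f g) 1 mu ≤ 2 * eLpNorm f 1 mu := by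
  have h : ∀ f : X → ℝ, AEStronglyMeasurable (mu[f | HH]) mu := fun f =>
    integrable_condExp.aestronglyMeasurable
  have b1 : eLpNorm (mu[f * g | HH]) 1 mu ≤ eLpNorm f 1 mu := by
    refine (eLpNorm_condExp_le_eLpNorm _ le_rfl).trans (eLpNorm_mono fun w => ?_)
    rw [Pi.mul_apply, norm_mul]
    exact mul_le_of_le_one_right (norm_nonneg _) (hg w)
  have b2 : eLpNorm (mu[f | HH] * mu[g | HH]) 1 mu ≤ eLpNorm f 1 mu := by
    refine le_trans (eLpNorm_mono_ae ?_) (eLpNorm_condExp_le_eLpNorm (m := HH) f le_rfl)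
    have := ae_bdd_abs_condExp_of_ae_bdd_abs (m := HH) (μ := mu) (R := 1) (f := g)
      (Eventually.of_forall hg)
    filter_upwards [this] with w hw
    rw [Pi.mul_apply, norm_mul]
    exact mul_le_of_le_one_right (norm_nonneg _) hw
  rw [cv, two_mul]
  exact (eLpNorm_sub_le (h _) ((h f).mul (h g)) le_rfl).trans (add_le_add b1 b2)

lemma cv_approx {f f' g : X → ℝ} (hf : Bd f) (hf' : Bd f') (hg : Bd g) (hg1 : ∀ w, |g w| ≤ 1) :
    eLpNorm (cv f g) 1 mu ≤ eLpNorm (cv f' g) 1 mu + 2 * eLpNorm (f - f') 1 mu := by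
  have hd : Bd (f - f') := by
    have := hf.add (hf'.smul (-1))
    rwa [neg_one_smul, ← sub_eq_add_neg] at this
  have e := cv_add hf' hd hg
  rw [add_sub_cancel] at e
  rw [eLpNorm_congr_ae e]
  exact (eLpNorm_add_le (cv_aesm _ _) (cv_aesm _ _) le_rfl).trans
    (add_le_add le_rfl (cv_le hg1))

/-! ### Mixing for characters -/

/-- Shift of a finitely supported vector. -/
noncomputable def sh (k : ℕ) (s : ℤ →₀ ZMod 2) : ℤ →₀ ZMod 2 := s.mapDomain (· + (k : ℤ))

lemma ch_comp (U s) (k : ℕ) : ch U s ∘ T^[k] = ch ((fun x => x + (k : ℤ_[3])) ⁻¹' U) (sh k s) := by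
  funext w
  have : pr (fun i => w.2 (i + k)) s = pr w.2 (sh k s) := by
    rw [pr, pr, sh, Finsupp.linearCombination_mapDomain]; rfl
  simp only [Function.comp, T_iter, ch, this]
  rfl

lemma ch_mul (U U' s s') : ch U s * ch U' s' = ch (U ∩ U') (s + s') := by
  classical
  funext w
  simp only [ch, Pi.mul_apply, map_add, sg_add, Set.indicator_apply, Set.mem_inter_iff]
  by_cases h1 : w.1 ∈ U <;> by_cases h2 : w.1 ∈ U' <;> simp [h1, h2]

lemma mem_Rel_iff {x : ℤ_[3]} {m M k : ℕ} (hk : 3 ^ m ≤ k) (hx : x ∉ Bad m M k)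
    {s s' : ℤ →₀ ZMod 2} (hs : ∀ j ∈ s.support, |j| ≤ M) (hs' : ∀ j ∈ s'.support, |j| ≤ M) :
    s + sh k s' ∈ Rel x ↔ s ∈ Rel x ∧ sh k s' ∈ Rel x := by
  classical
  refine ⟨fun h => ?_, fun h => add_mem h.1 h.2⟩
  simp only [Bad, Set.mem_union, Set.mem_ofPred_eq, not_or, not_le] at hx
  obtain ⟨d, p, q, hpq, hp, hq⟩ := exists_digit hk hx.1 hx.2
  have hs1 : s ∈ Rel x := by
    refine split (d := d) hpq ?_ ?_ (fun j hj => hp j (hs j hj)) (fun j hj => ?_) h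
    · rw [← hp 0 (by simp)]; exact dig_range _ _
    · rw [← hq 0 (by simp)]; exact dig_range _ _
    · have := Finsupp.mapDomain_support hj
      obtain ⟨i, hi, rfl⟩ := Finset.mem_image.mp this
      exact hq i (hs' i hi)
  refine ⟨hs1, ?_⟩
  have := sub_mem h hs1
  rwa [add_sub_cancel_left] at this

lemma exists_bound (s s' : ℤ →₀ ZMod 2) : ∃ M : ℕ, (∀ j ∈ s.support, |j| ≤ M) ∧
    (∀ j ∈ s'.support, |j| ≤ M) := by
  classical
  refine ⟨(s.support ∪ s'.support).sup Int.natAbs, fun j hj => ?_, fun j hj => ?_⟩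
  all_goals
    rw [Int.abs_eq_natAbs]
    exact_mod_cast Finset.le_sup (f := Int.natAbs) (by simp only [Finset.mem_union]; tauto)

/-- Mixing of a pair of functions, in `L¹`. -/
def Mix (f g : X → ℝ) : Prop :=
  Tendsto (fun k => eLpNorm (cv f (g ∘ T^[k])) 1 mu) atTop (nhds 0)

lemma mix_ch {U U' : Set ℤ_[3]} (hU : MeasurableSet U) (hU' : MeasurableSet U') (s s') :
    Mix (ch U s) (ch U' s') := by
  classical
  obtain ⟨M, hM, hM'⟩ := exists_bound s s'
  have bound : ∀ m k : ℕ, 3 ^ m ≤ k → eLpNorm (cv (ch U s) (ch U' s' ∘ T^[k])) 1 mu ≤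
      2 * ((4 * M : ℕ) * (3⁻¹ : ENNReal) ^ m) := by
    intro m k hk
    rw [ch_comp]
    have hV : MeasurableSet ((fun x => x + (k : ℤ_[3])) ⁻¹' U') := measurable_add_const3 _ hU'
    generalize (fun x => x + (k : ℤ_[3])) ⁻¹' U' = V at hV
    have e1 := condExp_ch (hU.inter hV) (s + sh k s')
    have e2 := condExp_ch hU s
    have e3 := condExp_ch hV (sh k s')
    have hle : eLpNorm (cv (ch U s) (ch V (sh k s'))) 1 mu ≤
        eLpNorm ((Prod.fst ⁻¹' (toMeasurable nu (Bad m M k))).indicator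
          (fun _ : X => (2 : ℝ))) 1 mu := by
      apply eLpNorm_mono_ae
      filter_upwards [e1, e2, e3] with w h1 h2 h3
      rw [cv, ch_mul, Pi.sub_apply, Pi.mul_apply, h1, h2, h3]
      by_cases hw : w.1 ∈ Bad m M k
      · rw [Set.indicator_of_mem (show w ∈ Prod.fst ⁻¹' _ from subset_toMeasurable _ _ hw)]
        refine (norm_sub_le _ _).trans ?_
        rw [norm_mul]
        have a1 := abs_ch_le (U ∩ V ∩ RS (s + sh k s')) (s + sh k s') w
        have a2 := abs_ch_le (U ∩ RS s) s w
        have a3 := abs_ch_le (V ∩ RS (sh k s')) (sh k s') w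
        simp only [Real.norm_eq_abs]
        have := mul_le_mul a2 a3 (abs_nonneg _) zero_le_one
        rw [abs_two]
        linarith
      · have : ch (U ∩ V ∩ RS (s + sh k s')) (s + sh k s') w =
            ch (U ∩ RS s) s w * ch (V ∩ RS (sh k s')) (sh k s') w := by
          rw [← Pi.mul_apply, ch_mul]
          have := mem_Rel_iff hk hw hM hM'
          simp only [ch]
          congr 1
          simp only [Set.indicator_apply, Set.mem_inter_iff, RS, Set.mem_ofPred_eq, this]
          congr 1
          simp only [eq_iff_iff]
          tauto
        rw [this, sub_self, norm_zero]
        exact norm_nonneg _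
    refine hle.trans ?_
    rw [eLpNorm_indicator_const (measurable_fst (measurableSet_toMeasurable _ _)) one_ne_zero
      ENNReal.one_ne_top]
    have : mu (Prod.fst ⁻¹' toMeasurable nu (Bad m M k)) = nu (Bad m M k) := by
      rw [mu, ← Set.prod_univ, Measure.prod_prod, measure_univ, mul_one, measure_toMeasurable]
    rw [this]
    simp only [ENNReal.toReal_one, div_one, ENNReal.rpow_one]
    have h2 : ‖(2 : ℝ)‖ₑ = 2 := by
      rw [Real.enorm_eq_ofReal (by norm_num)]; simp
    rw [h2]
    gcongr
    exact nu_Bad_le m M k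
  have lim : Tendsto (fun m : ℕ => 2 * ((4 * M : ℕ) * (3⁻¹ : ENNReal) ^ m)) atTop (nhds 0) := by
    have h0 : Tendsto (fun m : ℕ => (3⁻¹ : ENNReal) ^ m) atTop (nhds 0) :=
      ENNReal.tendsto_pow_atTop_nhds_zero_of_lt_one (ENNReal.inv_lt_one.mpr (by norm_num))
    have h1 := ENNReal.Tendsto.const_mul (a := ((4 * M : ℕ) : ENNReal)) h0
      (Or.inr (ENNReal.natCast_ne_top _))
    have h2 := ENNReal.Tendsto.const_mul (a := 2) h1 (Or.inr (by norm_num))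
    simpa using h2
  rw [Mix, ENNReal.tendsto_nhds_zero]
  intro ε hε
  obtain ⟨m, hm⟩ := (ENNReal.tendsto_nhds_zero.mp lim ε hε).exists
  filter_upwards [eventually_ge_atTop (3 ^ m)] with k hk
  exact (bound m k hk).trans hm

end RelMix

namespace RelMix
/-! ### Mixing for all sets -/

/-- The characters used to approximate measurable sets. -/
def Gen : Set (X → ℝ) := {f | ∃ U s, MeasurableSet U ∧ f = ch U s}

/-- Trigonometric polynomials. -/
noncomputable def SS : Submodule ℝ (X → ℝ) := Submodule.span ℝ Gen

lemma Bd_SS {f} (hf : f ∈ SS) : Bd f := by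
  induction hf using Submodule.span_induction with
  | mem f h => obtain ⟨U, s, hU, rfl⟩ := h; exact Bd_ch hU s
  | zero => exact ⟨measurable_const, 0, by simp⟩
  | add f g _ _ h1 h2 => exact h1.add h2
  | smul c f _ h => exact h.smul c

lemma Mix.add_left {f f' g} (hf : Bd f) (hf' : Bd f') (hg : Bd g) (h : Mix f g) (h' : Mix f' g) :
    Mix (f + f') g := by
  have := Tendsto.add h h'
  rw [add_zero] at this
  refine tendsto_of_tendsto_of_tendsto_of_le_of_le tendsto_const_nhds this (fun _ => zero_le) ?_
  intro k
  dsimp only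
  rw [eLpNorm_congr_ae (cv_add hf hf' (hg.comp k))]
  exact eLpNorm_add_le (cv_aesm _ _) (cv_aesm _ _) le_rfl

lemma Mix.smul_left {f g} (c : ℝ) (h : Mix f g) : Mix (c • f) g := by
  have := ENNReal.Tendsto.const_mul (a := ‖c‖ₑ) h (Or.inr enorm_ne_top)
  rw [mul_zero] at this
  refine this.congr fun k => ?_
  rw [eLpNorm_congr_ae (cv_smul c), eLpNorm_const_smul]

lemma Mix.add_right {f g g'} (hf : Bd f) (hg : Bd g) (hg' : Bd g') (h : Mix f g) (h' : Mix f g') :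
    Mix f (g + g') := by
  have := Tendsto.add h h'
  rw [add_zero] at this
  refine tendsto_of_tendsto_of_tendsto_of_le_of_le tendsto_const_nhds this (fun _ => zero_le) ?_
  intro k
  dsimp only
  have e : (g + g') ∘ T^[k] = g ∘ T^[k] + g' ∘ T^[k] := rfl
  rw [e, cv_comm, eLpNorm_congr_ae (cv_add (hg.comp k) (hg'.comp k) hf), cv_comm f, cv_comm f]
  exact eLpNorm_add_le (cv_aesm _ _) (cv_aesm _ _) le_rfl

lemma Mix.smul_right {f g} (c : ℝ) (h : Mix f g) : Mix f (c • g) := by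
  have := ENNReal.Tendsto.const_mul (a := ‖c‖ₑ) h (Or.inr enorm_ne_top)
  rw [mul_zero] at this
  refine this.congr fun k => ?_
  have e : (c • g) ∘ T^[k] = c • (g ∘ T^[k]) := rfl
  rw [e, cv_comm f (c • _), eLpNorm_congr_ae (cv_smul c), eLpNorm_const_smul, cv_comm f]

lemma cv_zero_left (g) : cv 0 g = 0 := by
  simp [cv, condExp_zero]

lemma mix_SS {f g} (hf : f ∈ SS) (hg : g ∈ SS) : Mix f g := by
  induction hf using Submodule.span_induction with
  | mem f h =>
    obtain ⟨U, s, hU, rfl⟩ := h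
    induction hg using Submodule.span_induction with
    | mem g h =>
      obtain ⟨U', s', hU', rfl⟩ := h
      exact mix_ch hU hU' s s'
    | zero =>
      have e : ∀ k, cv (ch U s) ((0 : X → ℝ) ∘ T^[k]) = 0 := by
        intro k
        have : (0 : X → ℝ) ∘ T^[k] = 0 := rfl
        rw [this, cv_comm, cv_zero_left]
      simp only [Mix, e, eLpNorm_zero]
      exact tendsto_const_nhds
    | add g g' h1 h2 i1 i2 => exact Mix.add_right (Bd_ch hU s) (Bd_SS h1) (Bd_SS h2) i1 i2
    | smul c g _ i => exact i.smul_right c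
  | zero => simp only [Mix, cv_zero_left, eLpNorm_zero]; exact tendsto_const_nhds
  | add f f' h1 h2 i1 i2 => exact Mix.add_left (Bd_SS h1) (Bd_SS h2) (Bd_SS hg) i1 i2
  | smul c f _ i => exact i.smul_left c

lemma SS_mul {f g} (hf : f ∈ SS) (hg : g ∈ SS) : f * g ∈ SS := by
  induction hf using Submodule.span_induction with
  | mem f h =>
    obtain ⟨U, s, hU, rfl⟩ := h
    induction hg using Submodule.span_induction with
    | mem g h =>
      obtain ⟨U', s', hU', rfl⟩ := h
      rw [ch_mul]
      exact Submodule.subset_span ⟨_, _, hU.inter hU', rfl⟩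
    | zero => rw [mul_zero]; exact zero_mem _
    | add g g' _ _ i1 i2 => rw [mul_add]; exact add_mem i1 i2
    | smul c g _ i => rw [mul_smul_comm]; exact Submodule.smul_mem _ _ i
  | zero => rw [zero_mul]; exact zero_mem _
  | add f f' _ _ i1 i2 => rw [add_mul]; exact add_mem i1 i2
  | smul c f _ i => rw [smul_mul_assoc]; exact Submodule.smul_mem _ _ i

/-- The indicator of a set. -/
noncomputable abbrev ind (A : Set X) : X → ℝ := A.indicator fun _ => (1 : ℝ)

/-- The algebra of simple sets. -/
def CC : Set (Set X) := {A | ind A ∈ SS}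

lemma ch_univ_zero : ch Set.univ 0 = ind Set.univ := by
  funext w; simp [ch, sg]

lemma CC_ring : IsSetRing CC where
  empty_mem := by
    show ind ∅ ∈ SS
    have : ind ∅ = 0 := by funext w; simp [ind]
    rw [this]; exact zero_mem _
  union_mem {A B} hA hB := by
    classical
    show ind (A ∪ B) ∈ SS
    have : ind (A ∪ B) = ind A + ind B - ind A * ind B := by
      funext w
      simp only [ind, Pi.sub_apply, Pi.add_apply, Pi.mul_apply, Set.indicator_apply, Set.mem_union]
      by_cases h1 : w ∈ A <;> by_cases h2 : w ∈ B <;> simp [h1, h2]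
    rw [this]
    exact sub_mem (add_mem hA hB) (SS_mul hA hB)
  sdiff_mem {A B} hA hB := by
    classical
    show ind (A \ B) ∈ SS
    have : ind (A \ B) = ind A - ind A * ind B := by
      funext w
      simp only [ind, Pi.sub_apply, Pi.mul_apply, Set.indicator_apply, Set.mem_sdiff]
      by_cases h1 : w ∈ A <;> by_cases h2 : w ∈ B <;> simp [h1, h2]
    rw [this]
    exact sub_mem hA (SS_mul hA hB)

lemma univ_CC : Set.univ ∈ CC := by
  show ind Set.univ ∈ SS
  rw [← ch_univ_zero]
  exact Submodule.subset_span ⟨_, _, MeasurableSet.univ, rfl⟩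

/-- Coordinate sets. -/
def Z0 (i : ℤ) : Set X := {w | w.2 i = 0}

lemma ind_Z0 (i : ℤ) : ind (Z0 i) =
    (1 / 2 : ℝ) • ch Set.univ 0 + (1 / 2 : ℝ) • ch Set.univ (Finsupp.single i 1) := by
  classical
  funext w
  simp only [ind, Z0, Set.indicator_apply, Set.mem_ofPred_eq, Pi.add_apply, Pi.smul_apply, ch,
    pr_single, sg, map_zero, Set.mem_univ, if_true, smul_eq_mul]
  split_ifs <;> norm_num

lemma Z0_CC (i : ℤ) : Z0 i ∈ CC := by
  show ind (Z0 i) ∈ SS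
  rw [ind_Z0]
  exact add_mem (Submodule.smul_mem _ _ (Submodule.subset_span ⟨_, _, MeasurableSet.univ, rfl⟩))
    (Submodule.smul_mem _ _ (Submodule.subset_span ⟨_, _, MeasurableSet.univ, rfl⟩))

lemma CC_meas {A} (hA : A ∈ CC) : MeasurableSet A := by
  have h := (Bd_SS hA).1
  have : A = ind A ⁻¹' {1} := by
    classical
    ext w
    simp [ind, Set.indicator_apply]
  rw [this]
  exact h (measurableSet_singleton 1)

lemma CC_gen : (inferInstance : MeasurableSpace X) = MeasurableSpace.generateFrom CC := by
  apply le_antisymm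
  · have hfst : ∀ U : Set ℤ_[3], MeasurableSet U → Prod.fst ⁻¹' U ∈ CC := by
      intro U hU
      show ind _ ∈ SS
      have : ind (Prod.fst ⁻¹' U) = ch U 0 := by
        funext w
        simp [ch, sg, ind]
        rfl
      rw [this]
      exact Submodule.subset_span ⟨_, _, hU, rfl⟩
    refine sup_le ?_ ?_
    · rintro _ ⟨U, hU, rfl⟩
      exact MeasurableSpace.measurableSet_generateFrom (hfst U hU)
    · rw [MeasurableSpace.pi, MeasurableSpace.comap_iSup]
      refine iSup_le fun i => ?_
      rw [MeasurableSpace.comap_comp]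
      rintro _ ⟨t, -, rfl⟩
      have hm : @Measurable X (ZMod 2) (MeasurableSpace.generateFrom CC) _ (fun w => w.2 i) := by
        refine @measurable_to_countable' _ _ _ _ (MeasurableSpace.generateFrom CC) _ ?_
        intro r
        have h0 := MeasurableSpace.measurableSet_generateFrom (Z0_CC i)
        have h01 : ∀ t : ZMod 2, t = 0 ∨ t = 1 := by decide
        have hne : ∀ t : ZMod 2, t = 1 ↔ ¬ t = 0 := by decide
        rcases h01 r with rfl | rfl
        · exact h0
        · have : (fun w : X => w.2 i) ⁻¹' {1} = (Z0 i)ᶜ := by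
            ext w
            simp only [Set.mem_preimage, Set.mem_singleton_iff, Z0, Set.mem_compl_iff,
              Set.mem_ofPred_eq]
            exact hne _
          rw [this]
          exact h0.compl
      exact hm (MeasurableSpace.measurableSet_top)
  · apply MeasurableSpace.generateFrom_le
    exact fun A hA => CC_meas hA

lemma approx {A : Set X} (hA : MeasurableSet A) {ε : ENNReal} (hε : 0 < ε) :
    ∃ A' ∈ CC, eLpNorm (ind A - ind A') 1 mu ≤ ε := by
  classical
  obtain ⟨t, ht, h⟩ := exists_measure_symmDiff_lt_of_generateFrom_isSetRing (μ := mu) CC_ring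
    ⟨{Set.univ}, Set.countable_singleton _, by simpa using univ_CC, by simp⟩ CC_gen hA hε
  refine ⟨t, ht, le_trans ?_ h.le⟩
  have hmeas : MeasurableSet (symmDiff t A) := (CC_meas ht).symmDiff hA
  have : eLpNorm ((symmDiff t A).indicator fun _ => (1 : ℝ)) 1 mu = mu (symmDiff t A) := by
    rw [eLpNorm_indicator_const hmeas one_ne_zero ENNReal.one_ne_top]
    simp
  rw [← this]
  refine eLpNorm_mono fun w => ?_
  simp only [ind, Pi.sub_apply, Set.indicator_apply, Set.mem_symmDiff]
  by_cases h1 : w ∈ A <;> by_cases h2 : w ∈ t <;> simp [h1, h2]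

lemma ind_le (A : Set X) (w) : |ind A w| ≤ 1 := by
  classical
  rw [ind, Set.indicator_apply]; split_ifs <;> simp

lemma mix_sets {A B : Set X} (hA : MeasurableSet A) (hB : MeasurableSet B) :
    Mix (ind A) (ind B) := by
  rw [Mix, ENNReal.tendsto_nhds_zero]
  intro ε hε
  have hε' : 0 < ε / 6 := ENNReal.div_pos hε.ne' (by norm_num)
  obtain ⟨A', hA', hAA⟩ := approx hA hε'
  obtain ⟨B', hB', hBB⟩ := approx hB hε'
  have hm := ENNReal.tendsto_nhds_zero.mp (mix_SS hA' hB') (ε / 6) hε'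
  filter_upwards [hm] with k hk
  have bA := Bd_ind hA
  have bA' := Bd_ind (CC_meas hA')
  have bB := (Bd_ind hB).comp k
  have bB' := (Bd_ind (CC_meas hB')).comp k
  have s1 := cv_approx bA bA' bB (fun w => ind_le B _)
  have s2 := cv_approx bB bB' bA' (ind_le A')
  rw [cv_comm _ (A'.indicator _), cv_comm _ (A'.indicator _)] at s2
  have s3 : eLpNorm (ind B ∘ T^[k] - ind B' ∘ T^[k]) 1 mu ≤ ε / 6 := by
    have e : ind B ∘ T^[k] - ind B' ∘ T^[k] = (ind B - ind B') ∘ T^[k] := rfl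
    rw [e, eLpNorm_comp_measurePreserving _ (T_mp.iterate k)]
    · exact hBB
    · exact ((Bd_ind hB).1.sub (Bd_ind (CC_meas hB')).1).aestronglyMeasurable
  calc _ ≤ _ := s1
    _ ≤ (ε / 6 + 2 * (ε / 6)) + 2 * (ε / 6) := by
        refine add_le_add (s2.trans ?_) ?_
        · gcongr
        · gcongr
    _ ≤ 6 * (ε / 6) := by
        have : (ε / 6 + 2 * (ε / 6)) + 2 * (ε / 6) = 5 * (ε / 6) := by ring
        rw [this]
        gcongr
        norm_num
    _ = ε := ENNReal.mul_div_cancel (by norm_num) (by norm_num)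

lemma two_mixing (A B : Set X) (hA : MeasurableSet A) (hB : MeasurableSet B) :
    TendstoInMeasure mu
      (fun k => mu[(A ∩ T^[k] ⁻¹' B).indicator (fun _ => (1:ℝ)) | HH]
        - mu[A.indicator (fun _ => (1:ℝ)) | HH]
          * mu[(T^[k] ⁻¹' B).indicator (fun _ => (1:ℝ)) | HH]) atTop 0 := by
  have e : ∀ k, mu[(A ∩ T^[k] ⁻¹' B).indicator (fun _ => (1:ℝ)) | HH]
        - mu[A.indicator (fun _ => (1:ℝ)) | HH]
          * mu[(T^[k] ⁻¹' B).indicator (fun _ => (1:ℝ)) | HH] = cv (ind A) (ind B ∘ T^[k]) := by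
    classical
    intro k
    have h1 : ind B ∘ T^[k] = (T^[k] ⁻¹' B).indicator (fun _ => (1:ℝ)) := rfl
    have h2 : (A ∩ T^[k] ⁻¹' B).indicator (fun _ => (1:ℝ)) =
        ind A * (T^[k] ⁻¹' B).indicator (fun _ => (1:ℝ)) := by
      funext w
      simp only [ind, Pi.mul_apply, Set.indicator_apply, Set.mem_inter_iff]
      by_cases h1 : w ∈ A <;> by_cases h2 : w ∈ T^[k] ⁻¹' B <;> simp [h1, h2]
    rw [h1, h2, cv]
  simp only [e]
  apply tendstoInMeasure_of_tendsto_eLpNorm one_ne_zero (fun k => cv_aesm _ _)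
    aestronglyMeasurable_zero
  simp only [sub_zero]
  exact mix_sets hA hB

/-! ### Failure of threefold mixing -/

lemma preimage_Z0 (k : ℕ) : T^[k] ⁻¹' Z0 0 = Z0 k := by
  ext w
  simp [Z0, T_iter]

lemma condExp_Z0 (i : ℤ) : mu[ind (Z0 i) | HH] =ᵐ[mu] fun _ => 1 / 2 := by
  have e0 := condExp_ch MeasurableSet.univ (0 : ℤ →₀ ZMod 2)
  have e1 := condExp_ch MeasurableSet.univ (Finsupp.single i 1)
  have b0 := (Bd_ch MeasurableSet.univ (0 : ℤ →₀ ZMod 2))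
  have b1 := (Bd_ch MeasurableSet.univ (Finsupp.single i (1 : ZMod 2)))
  have a := condExp_add (m := HH) (b0.smul (1 / 2)).integrable (b1.smul (1 / 2)).integrable
  have c0 := condExp_smul (μ := mu) (1 / 2 : ℝ) (ch Set.univ 0) HH
  have c1 := condExp_smul (μ := mu) (1 / 2 : ℝ) (ch Set.univ (Finsupp.single i 1)) HH
  rw [ind_Z0]
  filter_upwards [e0, e1, a, c0, c1] with w e0 e1 a c0 c1
  have hx : w.1 ∉ RS (Finsupp.single i 1) := single_notMem w.1 i
  have hx0 : w.1 ∈ RS 0 := zero_mem (Rel w.1)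
  rw [a, Pi.add_apply, c0, c1, Pi.smul_apply, Pi.smul_apply, e0, e1]
  simp [ch, hx, hx0, sg]

/-- The bad event for threefold mixing at scale `n`. -/
def Ev (n : ℕ) : Set X :=
  {x | ((0, n) : ℤ × ℕ) ∈ act x} ×ˢ {z | pr z (line (0, n)) = 1}

lemma Ev_HH (n : ℕ) : MeasurableSet[HH] (Ev n) := by
  refine ⟨(measurableSet_act _).prod (measurable_pr _ (measurableSet_singleton 1)), ?_⟩
  intro x z u hu
  simp only [Ev, Set.mem_prod, Set.mem_ofPred_eq]
  refine and_congr_right fun hx => ?_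
  rw [pr_add, hu _ hx, add_zero]

lemma nu_act (n : ℕ) : 3⁻¹ ≤ nu {x | ((0, n) : ℤ × ℕ) ∈ act x} := by
  set E := {x | ((0, n) : ℤ × ℕ) ∈ act x} with hE
  have hcov : (Set.univ : Set ℤ_[3]) ⊆ E ∪ ((fun x => x + ((-(3 ^ n) : ℤ) : ℤ_[3])) ⁻¹' E ∪
      (fun x => x + ((-(2 * 3 ^ n) : ℤ) : ℤ_[3])) ⁻¹' E) := by
    intro x _
    have key := dig_set_same n x 0 0 le_rfl (by norm_num)
    simp only [hE, act, Set.mem_union, Set.mem_preimage, Set.mem_ofPred_eq, Int.cast_zero, add_zero]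
    simp only [Int.cast_zero, add_zero] at key
    rcases dig_range n x with h | h | h
    · exact Or.inl h
    · right; left
      rw [h] at key
      rw [← key]; congr 3; ring
    · right; right
      rw [h] at key
      rw [← key]; congr 3; ring
  have h1 := (measure_mono (μ := nu) hcov).trans ((measure_union_le _ _).trans
    (add_le_add le_rfl (measure_union_le _ _)))
  rw [measure_univ, measure_preimage_add_right, measure_preimage_add_right] at h1
  have h2 : 1 ≤ nu E * 3 := by
    refine h1.trans (le_of_eq ?_)
    ring
  rw [ENNReal.inv_le_iff_le_mul (by simp) (by simp)]
  rw [mul_comm]; exact h2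

lemma lam_line (n : ℕ) : 2⁻¹ ≤ lam {z | pr z (line (0, n)) = 1} := by
  set E := {z | pr z (line (0, n)) = 1} with hE
  have hu : ∃ u, pr u (line (0, n)) = 1 := by
    refine ⟨fun i => if i = 0 then 1 else 0, ?_⟩
    rw [pr_line]
    simp
  obtain ⟨u, hu⟩ := hu
  have hcov : (Set.univ : Set (ℤ → ZMod 2)) ⊆ E ∪ (fun z => z + u) ⁻¹' E := by
    intro z _
    simp only [hE, Set.mem_union, Set.mem_preimage, Set.mem_ofPred_eq, pr_add, hu]
    generalize pr z (line (0, n)) = t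
    revert t; decide
  have h1 := (measure_mono (μ := lam) hcov).trans (measure_union_le _ _)
  rw [measure_univ, measure_preimage_add_right] at h1
  rw [ENNReal.inv_le_iff_le_mul (by simp) (by simp), two_mul]
  exact h1

lemma mu_Ev (n : ℕ) : 3⁻¹ * 2⁻¹ ≤ mu (Ev n) := by
  rw [mu, Ev, Measure.prod_prod]
  exact mul_le_mul' (nu_act n) (lam_line n)

lemma not_three :
    ¬ TendstoInMeasure mu
      (fun m => mu[(Z0 0 ∩ T^[3 ^ m] ⁻¹' Z0 0 ∩ T^[2 * 3 ^ m] ⁻¹' Z0 0).indicator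
            (fun _ => (1:ℝ)) | HH]
        - mu[(Z0 0).indicator (fun _ => (1:ℝ)) | HH]
          * mu[(T^[3 ^ m] ⁻¹' Z0 0).indicator (fun _ => (1:ℝ)) | HH]
          * mu[(T^[2 * 3 ^ m] ⁻¹' Z0 0).indicator (fun _ => (1:ℝ)) | HH]) atTop 0 := by
  classical
  intro H
  have H1 := H (ENNReal.ofReal (1 / 8)) (by simp)
  have key : ∀ m : ℕ, 3⁻¹ * 2⁻¹ ≤ mu {w | ENNReal.ofReal (1 / 8) ≤
      edist ((mu[(Z0 0 ∩ T^[3 ^ m] ⁻¹' Z0 0 ∩ T^[2 * 3 ^ m] ⁻¹' Z0 0).indicator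
            (fun _ => (1:ℝ)) | HH]
        - mu[(Z0 0).indicator (fun _ => (1:ℝ)) | HH]
          * mu[(T^[3 ^ m] ⁻¹' Z0 0).indicator (fun _ => (1:ℝ)) | HH]
          * mu[(T^[2 * 3 ^ m] ⁻¹' Z0 0).indicator (fun _ => (1:ℝ)) | HH]) w) 
          ((0 : X → ℝ) w)} := by
    intro m
    refine (mu_Ev m).trans (measure_mono_ae ?_)
    rw [preimage_Z0, preimage_Z0]
    have z0 := condExp_Z0 0
    have z1 := condExp_Z0 ((3 ^ m : ℕ) : ℤ)
    have z2 := condExp_Z0 ((2 * 3 ^ m : ℕ) : ℤ)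
    set W : Set X := Z0 0 ∩ Z0 ((3 ^ m : ℕ) : ℤ) ∩ Z0 ((2 * 3 ^ m : ℕ) : ℤ) with hW
    have hWm : MeasurableSet W :=
      ((CC_meas (Z0_CC _)).inter (CC_meas (Z0_CC _))).inter (CC_meas (Z0_CC _))
    have hdis : (Ev m).indicator (W.indicator fun _ => (1 : ℝ)) = 0 := by
      funext w
      by_cases h1 : w ∈ Ev m
      · by_cases h2 : w ∈ W
        · exfalso
          have h3 : pr w.2 (line (0, m)) = 1 := h1.2
          rw [pr_line] at h3
          obtain ⟨⟨a, b⟩, c⟩ := h2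
          simp only [Z0, Set.mem_ofPred_eq] at a b c
          push_cast at b c
          simp only [zero_mul, add_zero, one_mul, zero_add, a, b, c] at h3
          exact absurd h3 (by decide)
        · simp [h1, h2]
      · simp [h1]
    have ce := condExp_indicator (m := HH) (μ := mu) (Bd_ind hWm).integrable (Ev_HH m)
    rw [hdis, condExp_zero] at ce
    filter_upwards [z0, z1, z2, ce] with w z0 z1 z2 ce hw
    rw [Set.indicator_of_mem (show w ∈ Ev m from hw)] at ce
    show ENNReal.ofReal (1 / 8) ≤ edist _ _
    simp only [Pi.sub_apply, Pi.mul_apply, z0, z1, z2, ← ce, Pi.zero_apply]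
    rw [edist_dist, Real.dist_eq]
    apply ENNReal.ofReal_le_ofReal
    norm_num [abs_of_nonneg]
  have := ge_of_tendsto' H1 key
  simp at this

end RelMix

/-- Relative twofold mixing does not imply relative threefold mixing: there is a
measure-preserving system `(X, 𝓐, μ, T)` with a factor (invariant sub-σ-algebra) `𝓗`
which is `𝓗`-relatively twofold mixing — for all measurable `A, B`,
`μ(A ∩ T⁻ᵏB|𝓗) − μ(A|𝓗)μ(T⁻ᵏB|𝓗) → 0` in probability — but for which there are
measurable sets `A, B, C` and times `jₘ → ∞`, `kₘ − jₘ → ∞` along which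
`μ(A ∩ T⁻ʲᵐB ∩ T⁻ᵏᵐC|𝓗) − μ(A|𝓗)μ(T⁻ʲᵐB|𝓗)μ(T⁻ᵏᵐC|𝓗)` does not tend to `0`
in probability. -/
theorem relative_twofold_mixing_not_threefold :
    ∃ (X : Type) (mX : MeasurableSpace X) (μ : Measure X) (T : X → X)
      (𝓗 : { m : MeasurableSpace X // m ≤ mX }),
      IsProbabilityMeasure μ ∧
      MeasurePreserving T μ μ ∧
      (∀ s, MeasurableSet[𝓗.1] s → MeasurableSet[𝓗.1] (T ⁻¹' s)) ∧
      (∀ A B : Set X, MeasurableSet A → MeasurableSet B →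
        TendstoInMeasure μ
          (fun k => μ[(A ∩ T^[k] ⁻¹' B).indicator (fun _ => (1:ℝ)) | 𝓗.1]
            - μ[A.indicator (fun _ => (1:ℝ)) | 𝓗.1]
              * μ[(T^[k] ⁻¹' B).indicator (fun _ => (1:ℝ)) | 𝓗.1])
          atTop 0) ∧
      (∃ (A B C : Set X), MeasurableSet A ∧ MeasurableSet B ∧ MeasurableSet C ∧
        ∃ j k : ℕ → ℕ, Tendsto j atTop atTop ∧ Tendsto (fun m => k m - j m) atTop atTop ∧
          ¬ TendstoInMeasure μ
            (fun m => μ[(A ∩ T^[j m] ⁻¹' B ∩ T^[k m] ⁻¹' C).indicator (fun _ => (1:ℝ)) | 𝓗.1]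
              - μ[A.indicator (fun _ => (1:ℝ)) | 𝓗.1]
                * μ[(T^[j m] ⁻¹' B).indicator (fun _ => (1:ℝ)) | 𝓗.1]
                * μ[(T^[k m] ⁻¹' C).indicator (fun _ => (1:ℝ)) | 𝓗.1])
            atTop 0) := by
  have hpow : Tendsto (fun m : ℕ => 3 ^ m) atTop atTop :=
    tendsto_pow_atTop_atTop_of_one_lt (by norm_num)
  have hZ := RelMix.CC_meas (RelMix.Z0_CC 0)
  refine ⟨RelMix.X, inferInstance, RelMix.mu, RelMix.T, ⟨RelMix.HH, RelMix.HH_le⟩,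
    RelMix.instMuProb, RelMix.T_mp, RelMix.HH_inv, RelMix.two_mixing,
    RelMix.Z0 0, RelMix.Z0 0, RelMix.Z0 0, hZ, hZ, hZ, fun m => 3 ^ m, fun m => 2 * 3 ^ m,
    hpow, ?_, RelMix.not_three⟩
  refine hpow.congr fun m => ?_
  show 3 ^ m = 2 * 3 ^ m - 3 ^ m
  omega
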